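/- Let n ≥ 2. The set of real numbers of the form [x,z] with x ∈ dS^n and z ∈ Ξ is exactly the open interval (−1,1); the same holds with Ξ replaced by Ξ̄. That is, [dS^n, Ξ] ∩ ℝ = [dS^n, Ξ̄] ∩ ℝ = (−1,1). -/

import Mathlib

open scoped BigOperators
open Filter Topology

noncomputable section

/-- The Lorentzian bilinear form on `ℝ^{1+n}`. -/
def lformR (n : ℕ) (x y : Fin (n+1) → ℝ) : ℝ :=
  ∑ i, (if i = 0 then (-1 : ℝ) else 1) * x i * y i

/-- The complex-bilinear Lorentzian form on `ℂ^{1+n}`. -/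
def lformC (n : ℕ) (z w : Fin (n+1) → ℂ) : ℂ :=
  ∑ i, (if i = 0 then (-1 : ℂ) else 1) * z i * w i

/-- The matrix `η = diag(−1,1,…,1)`. -/
def eta (n : ℕ) : Matrix (Fin (n+1)) (Fin (n+1)) ℝ :=
  Matrix.diagonal (fun i => if i = 0 then (-1 : ℝ) else 1)

/-- Membership in `G = SO(1,n)_e`. -/
def memG (n : ℕ) (g : Matrix (Fin (n+1)) (Fin (n+1)) ℝ) : Prop :=
  g.transpose * eta n * g = eta n ∧ g.det = 1 ∧ 0 < g 0 0

/-- Standard basis vector `e₀`. -/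
def e0 (n : ℕ) : Fin (n+1) → ℝ := fun i => if i = 0 then 1 else 0

/-- Standard basis vector `eₙ`. -/
def elast (n : ℕ) : Fin (n+1) → ℝ := fun i => if i = Fin.last n then 1 else 0

/-- Membership in `H = SO(1,n−1)_e`, the stabilizer of `eₙ`. -/
def memH (n : ℕ) (g : Matrix (Fin (n+1)) (Fin (n+1)) ℝ) : Prop :=
  memG n g ∧ g.mulVec (elast n) = elast n

/-- Membership in `K = SO(n)`, the stabilizer of `e₀`. -/
def memK (n : ℕ) (g : Matrix (Fin (n+1)) (Fin (n+1)) ℝ) : Prop :=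
  memG n g ∧ g.mulVec (e0 n) = e0 n

/-- The boost `a_t`. -/
def boost (n : ℕ) (t : ℝ) : Matrix (Fin (n+1)) (Fin (n+1)) ℝ :=
  Matrix.of fun i j =>
    if i = 0 ∧ j = 0 then Real.cosh t
    else if i = Fin.last n ∧ j = Fin.last n then Real.cosh t
    else if (i = 0 ∧ j = Fin.last n) ∨ (i = Fin.last n ∧ j = 0) then Real.sinh t
    else if i = j then 1 else 0

/-- The upper hemisphere `S^n_+ = {(ix₀, 𝐱) : x₀ > 0, x₀² + |𝐱|² = 1}` in `ℂ^{1+n}`. -/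
def Snplus (n : ℕ) : Set (Fin (n+1) → ℂ) :=
  {z | ∃ x : Fin (n+1) → ℝ, 0 < x 0 ∧ (∑ i, (x i)^2) = 1 ∧
    z 0 = Complex.I * (x 0 : ℂ) ∧ ∀ i, i ≠ 0 → z i = (x i : ℂ)}

/-- The crown domain `Ξ = G · S^n_+ ⊂ ℂ^{1+n}`. -/
def Xi (n : ℕ) : Set (Fin (n+1) → ℂ) :=
  {z | ∃ g w, memG n g ∧ w ∈ Snplus n ∧ z = (g.map (Complex.ofReal)).mulVec w}

/-- The conjugate crown `Ξ̄`. -/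
def XiBar (n : ℕ) : Set (Fin (n+1) → ℂ) :=
  {z | (fun i => (starRingEnd ℂ) (z i)) ∈ Xi n}

/-- The de Sitter space `dS^n` viewed inside `ℂ^{1+n}`. -/
def dSC (n : ℕ) : Set (Fin (n+1) → ℂ) :=
  {z | (∀ i, (z i).im = 0) ∧ lformC n z z = 1}

/-- The cut `[1,∞) ⊂ ℂ`. -/
def slit : Set ℂ := {z | z.im = 0 ∧ 1 ≤ z.re}

/-- Componentwise complex conjugation on `ℂ^{1+n}`. -/
def conjVec (n : ℕ) (z : Fin (n+1) → ℂ) : Fin (n+1) → ℂ :=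
  fun i => (starRingEnd ℂ) (z i)

/-- `λ` is admissible: purely imaginary with nonnegative imaginary part, or
real with `0 < λ < ρ = (n−1)/2`. -/
def admissible (n : ℕ) (lam : ℂ) : Prop :=
  (lam.re = 0 ∧ 0 ≤ lam.im) ∨ (lam.im = 0 ∧ 0 < lam.re ∧ lam.re < ((n : ℝ) - 1)/2)

/-- Euler's integral representation of `₂F₁(ρ+λ, ρ−λ; n/2; ·)` on `ℂ∖[1,∞)`,
with `ρ = (n−1)/2`. -/
def Flam (n : ℕ) (lam : ℂ) (z : ℂ) : ℂ :=
  (Complex.Gamma ((n : ℂ)/2) /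
    (Complex.Gamma (((n : ℂ) - 1)/2 - lam) * Complex.Gamma (1/2 + lam))) *
  ∫ t in (0:ℝ)..1, (t : ℂ) ^ (((n : ℂ) - 1)/2 - lam - 1) *
    ((1 : ℂ) - (t : ℂ)) ^ (lam - 1/2) *
    ((1 : ℂ) - z * (t : ℂ)) ^ (-(((n : ℂ) - 1)/2) - lam)

/-- General term of the Gauss hypergeometric series `₂F₁(a,b;c;w)`. -/
def hypTerm (a b c : ℂ) (w : ℂ) (k : ℕ) : ℂ :=
  (ascPochhammer ℂ k).eval a * (ascPochhammer ℂ k).eval b /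
    ((ascPochhammer ℂ k).eval c * (k.factorial : ℂ)) * w ^ k

/-- The curve `z_t = (i cos t, 0, …, 0, sin t)` in the crown `Ξ`. -/
def zCurve (n : ℕ) (t : ℝ) : Fin (n+1) → ℂ :=
  fun i => if i = 0 then Complex.I * (Real.cos t : ℂ)
    else if i = Fin.last n then (Real.sin t : ℂ) else 0

/-- The curve `z̃_t = (−i cos t, 0, …, 0, sin t)` in the conjugate crown `Ξ̄`. -/
def zCurveBar (n : ℕ) (t : ℝ) : Fin (n+1) → ℂ :=
  fun i => if i = 0 then -Complex.I * (Real.cos t : ℂ)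
    else if i = Fin.last n then (Real.sin t : ℂ) else 0

/-- The open future cone `Γ⁺(eₙ)` in `dS^n`. -/
def futureCone (n : ℕ) : Set (Fin (n+1) → ℝ) :=
  {y | lformR n y y = 1 ∧ lformR n (y - elast n) (y - elast n) < 0 ∧ 0 < y 0}

/-- The open past cone `Γ⁻(eₙ)` in `dS^n`. -/
def pastCone (n : ℕ) : Set (Fin (n+1) → ℝ) :=
  {y | lformR n y y = 1 ∧ lformR n (y - elast n) (y - elast n) < 0 ∧ y 0 < 0}


/-- The boundary value expression in Statement 12 (sign `s = ∓1` for `x ± i0`). -/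
def bval (n : ℕ) (lam : ℂ) (x : ℝ) (s : ℝ) : ℂ :=
  (Complex.Gamma ((n : ℂ)/2) * Complex.Gamma ((2 - (n : ℂ))/2) /
      (Complex.Gamma (1/2 + lam) * Complex.Gamma (1/2 - lam))) *
    ∑' k : ℕ, hypTerm (((n : ℂ) - 1)/2 + lam) (((n : ℂ) - 1)/2 - lam) ((n : ℂ)/2)
      ((1 : ℂ) - x) k
  + Complex.exp ((s : ℂ) * (Real.pi : ℂ) * Complex.I * ((2 - (n : ℂ))/2)) *
      (((x - 1) ^ ((2 - (n : ℝ))/2) : ℝ) : ℂ) *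
      (Complex.Gamma ((n : ℂ)/2) * Complex.Gamma (((n : ℂ) - 2)/2) /
        (Complex.Gamma (((n : ℂ) - 1)/2 + lam) * Complex.Gamma (((n : ℂ) - 1)/2 - lam))) *
    ∑' k : ℕ, hypTerm (1/2 - lam) (1/2 + lam) ((4 - (n : ℂ))/2) ((1 : ℂ) - x) k

end

section

open scoped Matrix

theorem lformC_eq_dotProduct (n : ℕ) (z w : Fin (n+1) → ℂ) :
    lformC n z w = z ⬝ᵥ (eta n).map Complex.ofReal *ᵥ w := by
  have h : (eta n).map Complex.ofReal =
      Matrix.diagonal (fun i => if i = 0 then (-1 : ℂ) else 1) := by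
    rw [eta, Matrix.diagonal_map Complex.ofReal_zero]
    congr 1
    funext i
    split_ifs <;> simp
  rw [h, lformC, dotProduct]
  refine Finset.sum_congr rfl fun i _ => ?_
  rw [Matrix.mulVec_diagonal]
  ring

theorem lformC_mulVec_mulVec {n : ℕ} {g : Matrix (Fin (n+1)) (Fin (n+1)) ℝ}
    (hg : g.transpose * eta n * g = eta n) (z w : Fin (n+1) → ℂ) :
    lformC n (g.map Complex.ofReal *ᵥ z) (g.map Complex.ofReal *ᵥ w) = lformC n z w := by
  have h : (g.map Complex.ofReal).transpose * (eta n).map Complex.ofReal * g.map Complex.ofReal =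
      (eta n).map Complex.ofReal := by
    conv_rhs => rw [← hg]
    exact ((Matrix.map_mul (f := Complex.ofRealHom)).trans
      (congrArg (· * g.map Complex.ofReal) (Matrix.map_mul (f := Complex.ofRealHom)))).symm
  rw [lformC_eq_dotProduct, lformC_eq_dotProduct]
  conv_rhs => rw [← h]
  rw [← Matrix.mulVec_mulVec, ← Matrix.mulVec_mulVec, Matrix.dotProduct_mulVec z,
    Matrix.vecMul_transpose]

theorem eta_mul_eta (n : ℕ) : eta n * eta n = 1 := by
  rw [eta, Matrix.diagonal_mul_diagonal, ← Matrix.diagonal_one]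
  congr 1
  funext i
  split_ifs <;> simp

theorem mul_eta_transpose_eta {n : ℕ} {g : Matrix (Fin (n+1)) (Fin (n+1)) ℝ}
    (hg : g.transpose * eta n * g = eta n) : g * (eta n * g.transpose * eta n) = 1 := by
  rw [mul_eq_one_comm, Matrix.mul_assoc, Matrix.mul_assoc, ← Matrix.mul_assoc g.transpose, hg,
    eta_mul_eta]

theorem lformC_succ (n : ℕ) (z w : Fin (n+1) → ℂ) :
    lformC n z w = -(z 0 * w 0) + ∑ i : Fin n, z i.succ * w i.succ := by
  simp [lformC, Fin.sum_univ_succ]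

/-- A point of de Sitter space pairs with a point of the hemisphere to a real number only if
that number lies in `(-1, 1)`. -/
theorem mem_Ioo_of_lformC_Snplus {n : ℕ} {y : Fin (n+1) → ℝ} {w : Fin (n+1) → ℂ} {r : ℝ}
    (hy : lformC n (fun i => (y i : ℂ)) (fun i => (y i : ℂ)) = 1) (hw : w ∈ Snplus n)
    (hr : lformC n (fun i => (y i : ℂ)) w = r) : r ∈ Set.Ioo (-1 : ℝ) 1 := by
  obtain ⟨u, hu0, hu1, hw0, hwi⟩ := hw
  rw [lformC_succ] at hy hr
  simp only [hw0, hwi _ (Fin.succ_ne_zero _)] at hr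
  norm_cast at hy
  have him := congrArg Complex.im hr
  have hre := congrArg Complex.re hr
  simp only [← Complex.ofReal_mul, ← Complex.ofReal_sum] at him hre
  simp at him hre
  have hy0 : y 0 = 0 := by
    rcases him with h | h
    · exact h
    · exact absurd h hu0.ne'
  rw [Fin.sum_univ_succ] at hu1
  have hcs := Finset.sum_mul_sq_le_sq_mul_sq Finset.univ (fun i : Fin n => y i.succ)
    (fun i => u i.succ)
  have hy1 : ∑ i : Fin n, y i.succ ^ 2 = 1 := by
    rw [hy0] at hy
    simpa [sq] using hy
  rw [hre, hy1] at hcs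
  rw [Set.mem_Ioo, ← abs_lt, ← sq_lt_one_iff_abs_lt_one]
  nlinarith [pow_pos hu0 2]

theorem mem_Ioo_of_lformC_Xi {n : ℕ} {x z : Fin (n+1) → ℂ} {r : ℝ}
    (hx : x ∈ dSC n) (hz : z ∈ Xi n) (hr : lformC n x z = r) : r ∈ Set.Ioo (-1 : ℝ) 1 := by
  obtain ⟨g, w, ⟨hg, -, -⟩, hw, rfl⟩ := hz
  obtain ⟨him, hx1⟩ := hx
  set y : Fin (n+1) → ℝ := (eta n * g.transpose * eta n) *ᵥ fun i => (x i).re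
  have hxy : x = g.map Complex.ofReal *ᵥ fun i => (y i : ℂ) := by
    have hgy : g *ᵥ y = fun i => (x i).re := by
      rw [Matrix.mulVec_mulVec, mul_eta_transpose_eta hg, Matrix.one_mulVec]
    funext i
    have h := congrArg Complex.ofReal (congrFun hgy i)
    refine (Complex.ext rfl (him i) : x i = ((x i).re : ℂ)).trans (h.symm.trans ?_)
    simp [Matrix.mulVec, dotProduct]
  rw [hxy, lformC_mulVec_mulVec hg] at hr hx1
  exact mem_Ioo_of_lformC_Snplus hx1 hw hr

theorem Snplus_subset_Xi (n : ℕ) : Snplus n ⊆ Xi n := fun w hw =>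
  ⟨1, w, ⟨by simp, by simp, by simp⟩, hw, by
    rw [Matrix.map_one _ Complex.ofReal_zero Complex.ofReal_one, Matrix.one_mulVec]⟩

theorem exists_lformC_eq_of_mem_Ioo {n : ℕ} (hn : n ≠ 0) {r : ℝ} (hr : r ∈ Set.Ioo (-1 : ℝ) 1) :
    ∃ x ∈ dSC n, ∃ z ∈ Xi n, lformC n x z = r := by
  obtain ⟨m, rfl⟩ := Nat.exists_eq_succ_of_ne_zero hn
  have hr2 : 0 < 1 - r ^ 2 := by nlinarith [hr.1, hr.2]
  refine ⟨Fin.cons 0 (Pi.single 0 1), ⟨fun i => ?_, ?_⟩,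
    Fin.cons (Complex.I * (√(1 - r ^ 2) : ℝ)) (Pi.single 0 (r : ℂ)), Snplus_subset_Xi _
      ⟨Fin.cons √(1 - r ^ 2) (Pi.single 0 r), ?_, ?_, rfl, fun i hi => ?_⟩, ?_⟩
  · refine Fin.cases (by simp) (fun j => ?_) i
    by_cases hj : j = 0 <;> simp [hj]
  · rw [lformC_succ]
    simp [Pi.single_apply]
  · simpa using Real.sqrt_pos.2 hr2
  · rw [Fin.sum_univ_succ]
    simp [Pi.single_apply, ite_pow, Real.sq_sqrt hr2.le]
  · obtain ⟨j, rfl⟩ := Fin.exists_succ_eq.2 hi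
    by_cases hj : j = 0 <;> simp [hj]
  · rw [lformC_succ]
    simp [Pi.single_apply]

theorem lformC_conjVec {n : ℕ} {x : Fin (n+1) → ℂ} (hx : ∀ i, (x i).im = 0)
    (z : Fin (n+1) → ℂ) : lformC n x (conjVec n z) = (starRingEnd ℂ) (lformC n x z) := by
  have h : ∀ i, (starRingEnd ℂ) (x i) = x i := fun i => Complex.conj_eq_iff_im.2 (hx i)
  simp [lformC_succ, conjVec, h]

theorem conjVec_conjVec (n : ℕ) (z : Fin (n+1) → ℂ) : conjVec n (conjVec n z) = z := by
  funext i
  simp [conjVec]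

theorem exists_lformC_XiBar_iff {n : ℕ} {r : ℝ} :
    (∃ x ∈ dSC n, ∃ z ∈ XiBar n, lformC n x z = r) ↔
      ∃ x ∈ dSC n, ∃ z ∈ Xi n, lformC n x z = r := by
  refine exists_congr fun x => and_congr_right fun hx => ⟨?_, ?_⟩
  · rintro ⟨z, hz, h⟩
    exact ⟨conjVec n z, hz, by rw [lformC_conjVec hx.1, h, Complex.conj_ofReal]⟩
  · rintro ⟨z, hz, h⟩
    refine ⟨conjVec n z, ?_, by rw [lformC_conjVec hx.1, h, Complex.conj_ofReal]⟩
    change conjVec n (conjVec n z) ∈ Xi n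
    rwa [conjVec_conjVec]

end

theorem stmt3 (n : ℕ) (hn : 2 ≤ n) :
    {r : ℝ | ∃ x ∈ dSC n, ∃ z ∈ Xi n, lformC n x z = (r : ℂ)} = Set.Ioo (-1 : ℝ) 1 ∧
    {r : ℝ | ∃ x ∈ dSC n, ∃ z ∈ XiBar n, lformC n x z = (r : ℂ)} = Set.Ioo (-1 : ℝ) 1 := by
  have h : {r : ℝ | ∃ x ∈ dSC n, ∃ z ∈ Xi n, lformC n x z = (r : ℂ)} = Set.Ioo (-1 : ℝ) 1 :=
    Set.ext fun _ => ⟨fun ⟨_, hx, _, hz, hr⟩ => mem_Ioo_of_lformC_Xi hx hz hr,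
      exists_lformC_eq_of_mem_Ioo (by lia)⟩
  exact ⟨h, (Set.ext fun _ => exists_lformC_XiBar_iff).trans h⟩
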